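/- Let F be a finite set of m ≥ 1 features with model π, instance v and similarity relations as above, and let ν_a(S) = 1 if S is a WAXp and 0 otherwise. If feature i ∈ F is relevant (belongs to at least one AXp), then its Shapley value with respect to ν_a is strictly positive: Sc(i) = Σ_{S ⊆ F\{i}} (|S|!·(m−|S|−1)!/m!) · (ν_a(S ∪ {i}) − ν_a(S)) > 0. -/

import Mathlib

open Finset

/-- A set `S` of features is a weak abductive explanation (WAXp): for every point `x`
of feature space, if `x` is similar to `v` on all features in `S`, then the model
output at `x` is similar to the output at `v`. -/
def WAXp {m : ℕ} {D : Fin m → Type*} {T : Type*}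
    (π : (∀ i, D i) → T) (v : ∀ i, D i)
    (simD : ∀ i, D i → D i → Prop) (simT : T → T → Prop)
    (S : Finset (Fin m)) : Prop :=
  ∀ x : ∀ i, D i, (∀ i ∈ S, simD i (x i) (v i)) → simT (π x) (π v)

/-- An AXp is a subset-minimal WAXp. -/
def AXp {m : ℕ} {D : Fin m → Type*} {T : Type*}
    (π : (∀ i, D i) → T) (v : ∀ i, D i)
    (simD : ∀ i, D i → D i → Prop) (simT : T → T → Prop)
    (S : Finset (Fin m)) : Prop :=
  WAXp π v simD simT S ∧ ∀ S' ⊂ S, ¬ WAXp π v simD simT S'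

/-- The characteristic function `ν_a`: takes value 1 on WAXps and 0 otherwise. -/
noncomputable def nuA {m : ℕ} {D : Fin m → Type*} {T : Type*}
    (π : (∀ i, D i) → T) (v : ∀ i, D i)
    (simD : ∀ i, D i → D i → Prop) (simT : T → T → Prop)
    (S : Finset (Fin m)) : ℝ := by
  classical exact if WAXp π v simD simT S then 1 else 0

/-- The Shapley value (SHAP score) of feature `i` w.r.t. the characteristic
function `ν_a`. -/
noncomputable def Sc {m : ℕ} {D : Fin m → Type*} {T : Type*}
    (π : (∀ i, D i) → T) (v : ∀ i, D i)
    (simD : ∀ i, D i → D i → Prop) (simT : T → T → Prop)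
    (i : Fin m) : ℝ :=
  ∑ S ∈ (Finset.univ.erase i).powerset,
    ((Nat.factorial S.card : ℝ) * (Nat.factorial (m - S.card - 1) : ℝ) /
        (Nat.factorial m : ℝ)) *
      (nuA π v simD simT (insert i S) - nuA π v simD simT S)

section

variable {m : ℕ} {D : Fin m → Type*} {T : Type*} {π : (∀ i, D i) → T} {v : ∀ i, D i}
  {simD : ∀ i, D i → D i → Prop} {simT : T → T → Prop} {S S' : Finset (Fin m)}

theorem WAXp.mono (hS : S ⊆ S') (h : WAXp π v simD simT S) : WAXp π v simD simT S' :=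
  fun x hx => h x fun i hi => hx i (hS hi)

theorem nuA_eq_one (h : WAXp π v simD simT S) : nuA π v simD simT S = 1 := by
  simp [nuA, h]

theorem nuA_eq_zero (h : ¬ WAXp π v simD simT S) : nuA π v simD simT S = 0 := by
  simp [nuA, h]

theorem nuA_nonneg : 0 ≤ nuA π v simD simT S := by
  by_cases h : WAXp π v simD simT S
  · simp [nuA_eq_one h]
  · simp [nuA_eq_zero h]

theorem nuA_mono (hS : S ⊆ S') : nuA π v simD simT S ≤ nuA π v simD simT S' := by
  by_cases h : WAXp π v simD simT S
  · rw [nuA_eq_one h, nuA_eq_one (h.mono hS)]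
  · rw [nuA_eq_zero h]
    exact nuA_nonneg

end

/-- a relevant feature has strictly positive Shapley value w.r.t. `ν_a`. -/
theorem relevant_shap_pos {m : ℕ} {D : Fin m → Type*} {T : Type*}
    (π : (∀ i, D i) → T) (v : ∀ i, D i)
    (simD : ∀ i, D i → D i → Prop) (simT : T → T → Prop)
    (hm : 1 ≤ m) (i : Fin m)
    (hrel : ∃ A : Finset (Fin m), AXp π v simD simT A ∧ i ∈ A) :
    0 < Sc π v simD simT i := by
  obtain ⟨A, ⟨hA, hmin⟩, hi⟩ := hrel
  refine Finset.sum_pos' (fun S _ => ?_) ⟨A.erase i, ?_, ?_⟩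
  · exact mul_nonneg (by positivity) (sub_nonneg.2 (nuA_mono (Finset.subset_insert i S)))
  · exact Finset.mem_powerset.2 (Finset.erase_subset_erase i (Finset.subset_univ A))
  · rw [Finset.insert_erase hi, nuA_eq_one hA, nuA_eq_zero (hmin _ (Finset.erase_ssubset hi))]
    positivity
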